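/- arXiv:1302.4117 — 2 statements merged into one kernel-verified Lean document; each statement's English description precedes it below -/
import Mathlib

section
/- Let c₀ ≥ 1 be an integer and let ψ be analytic on ℂ₀ such that ψ agrees on some half-plane ℂ_{σ₀} with a convergent Dirichlet series ∑_{n≥1} c_n n^{−s}. If Re(c₀·s + ψ(s)) > 0 for every s ∈ ℂ₀, then Re ψ(s) ≥ 0 on ℂ₀; moreover, either ψ is a constant of real part 0, or Re ψ(s) > 0 for every s ∈ ℂ₀. -/
open Complex Filter

lemma norm_le_tsum_norm_term_of_LSeriesHasSum {c : ℕ → ℂ} {s t a b : ℂ}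
    (hs : LSeriesHasSum c s a) (ht : LSeriesHasSum c t b) (hst : s.re ≤ t.re) :
    ‖b‖ ≤ ∑' n, ‖LSeries.term c s n‖ := by
  have hsum : Summable fun n ↦ ‖LSeries.term c s n‖ := hs.summable.norm
  have h : Summable fun n ↦ ‖LSeries.term c t n‖ := ht.summable.norm
  rw [← ht.tsum_eq]
  exact (norm_tsum_le_tsum_norm h).trans
    (h.tsum_le_tsum (fun n ↦ LSeries.norm_term_le_of_re_le_re c hst n) hsum)

lemma normSq_add_conj_sub_normSq_sub (a b : ℂ) :
    ‖a + (starRingEnd ℂ) b‖ ^ 2 - ‖a - b‖ ^ 2 = 4 * a.re * b.re := by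
  simp only [Complex.sq_norm, Complex.normSq_apply, add_re, add_im, sub_re, sub_im, conj_re,
    conj_im]
  ring

lemma add_conj_ne_zero {a b : ℂ} (ha : 0 < a.re) (hb : 0 < b.re) :
    a + (starRingEnd ℂ) b ≠ 0 := by
  intro h
  have := congrArg re h
  simp only [add_re, conj_re, zero_re] at this
  linarith

lemma norm_sub_div_add_conj_lt_one {a b : ℂ} (ha : 0 < a.re) (hb : 0 < b.re) :
    ‖(a - b) / (a + (starRingEnd ℂ) b)‖ < 1 := by
  have hpos : 0 < ‖a + (starRingEnd ℂ) b‖ := norm_pos_iff.2 (add_conj_ne_zero ha hb)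
  rw [norm_div, div_lt_one hpos]
  have := normSq_add_conj_sub_normSq_sub a b
  have := mul_pos ha hb
  exact lt_of_pow_lt_pow_left₀ 2 hpos.le (by linarith)

/-- The Schwarz-Pick inequality on the right half-plane, based at a point of the real axis. -/
lemma norm_sub_div_add_conj_le_of_re_pos {h : ℂ → ℂ} (hd : DifferentiableOn ℂ h {s | 0 < s.re})
    (hpos : ∀ s : ℂ, 0 < s.re → 0 < (h s).re) {s : ℂ} (hs : 0 < s.re) {x : ℝ} (hx : 0 < x) :
    ‖(h s - h x) / (h s + (starRingEnd ℂ) (h x))‖ ≤ ‖(s - x) / (s + x)‖ := by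
  have hxre : 0 < (x : ℂ).re := by simpa using hx
  let p : ℂ → ℂ := fun w ↦ x * (1 + w) / (1 - w)
  let g : ℂ → ℂ := fun w ↦ (h (p w) - h x) / (h (p w) + (starRingEnd ℂ) (h x))
  have hne : ∀ w ∈ Metric.ball (0 : ℂ) 1, 1 - w ≠ 0 := by
    intro w hw h0
    rw [mem_ball_zero_iff, ← sub_eq_zero.1 h0] at hw
    simp at hw
  have hp : Set.MapsTo p (Metric.ball 0 1) {s | 0 < s.re} := by
    intro w hw
    have h1 : 0 < normSq (1 - w) := normSq_pos.2 (hne w hw)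
    have h2 : normSq w < 1 := by
      rw [mem_ball_zero_iff] at hw
      rw [← Complex.sq_norm]
      nlinarith [norm_nonneg w]
    have h3 : (p w).re = x * (1 - normSq w) / normSq (1 - w) := by
      simp only [p, div_re, re_ofReal_mul, im_ofReal_mul, add_re, add_im, one_re, one_im, sub_re,
        sub_im]
      rw [← add_div]
      congr 1
      rw [normSq_apply]
      ring
    change 0 < (p w).re
    rw [h3]
    exact div_pos (mul_pos hx (by linarith)) h1
  have hpd : DifferentiableOn ℂ p (Metric.ball 0 1) :=
    DifferentiableOn.div (by fun_prop) (by fun_prop) hne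
  have hcomp : DifferentiableOn ℂ (fun w ↦ h (p w)) (Metric.ball 0 1) := hd.comp hpd hp
  have hgd : DifferentiableOn ℂ g (Metric.ball 0 1) :=
    (hcomp.sub_const _).div (hcomp.add_const _)
      fun w hw ↦ add_conj_ne_zero (hpos _ (hp hw)) (hpos _ hxre)
  have hgm : Set.MapsTo g (Metric.ball 0 1) (Metric.ball 0 1) := fun w hw ↦
    mem_ball_zero_iff.2 (norm_sub_div_add_conj_lt_one (hpos _ (hp hw)) (hpos _ hxre))
  have hg0 : g 0 = 0 := by simp [g, p]
  have hw : ‖(s - x) / (s + x)‖ < 1 := by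
    simpa using norm_sub_div_add_conj_lt_one hs hxre
  have hsx : s + x ≠ 0 := by simpa using add_conj_ne_zero hs hxre
  have hx0 : (x : ℂ) ≠ 0 := by exact_mod_cast hx.ne'
  have hps : p ((s - x) / (s + x)) = s := by
    have h1 : 1 - (s - x) / (s + x) = 2 * x / (s + x) := by field_simp; ring
    have h2 : 1 + (s - x) / (s + x) = 2 * s / (s + x) := by field_simp; ring
    simp only [p, h1, h2]
    field_simp
  have key := Complex.norm_le_norm_of_mapsTo_ball hgd
    (hgm.mono_right Metric.ball_subset_closedBall) hg0 hw
  simpa only [g, hps] using key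

/-- Julia's lemma for the right half-plane. -/
lemma mul_re_le_re_of_tendsto_div {h : ℂ → ℂ} (hd : DifferentiableOn ℂ h {s | 0 < s.re})
    (hpos : ∀ s : ℂ, 0 < s.re → 0 < (h s).re) {a : ℝ} (ha : 0 < a)
    (hlim : Tendsto (fun x : ℝ ↦ h x / x) atTop (nhds (a : ℂ))) {s : ℂ} (hs : 0 < s.re) :
    a * s.re ≤ (h s).re := by
  have hinv : Tendsto (fun x : ℝ ↦ ((x⁻¹ : ℝ) : ℂ)) atTop (nhds 0) := by
    simpa [Function.comp_def] using (continuous_ofReal.tendsto 0).comp tendsto_inv_atTop_zero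
  have hconst : ∀ z : ℂ, Tendsto (fun x : ℝ ↦ z / x) atTop (nhds 0) := fun z ↦ by
    simpa [div_eq_mul_inv] using hinv.const_mul z
  have hL : Tendsto (fun x : ℝ ↦ s.re * ‖h s / x + (starRingEnd ℂ) (h x / x)‖ ^ 2) atTop
      (nhds (s.re * a ^ 2)) := by
    have := ((hconst (h s)).add ((continuous_conj.tendsto _).comp hlim)).norm.pow 2
    simpa using this.const_mul s.re
  have hR : Tendsto (fun x : ℝ ↦ (h s).re * (h x / x).re * ‖s / x + 1‖ ^ 2) atTop
      (nhds ((h s).re * a)) := by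
    have h1 := ((hconst s).add_const 1).norm.pow 2
    have h2 := ((continuous_re.tendsto _).comp hlim).const_mul (h s).re
    simpa using h2.mul h1
  have hle : s.re * a ^ 2 ≤ (h s).re * a := by
    refine le_of_tendsto_of_tendsto hL hR ?_
    filter_upwards [eventually_gt_atTop 0] with x hx
    have hxre : 0 < (x : ℂ).re := by simpa using hx
    have hx0 : (x : ℂ) ≠ 0 := by exact_mod_cast hx.ne'
    have key := norm_sub_div_add_conj_le_of_re_pos hd hpos hs hx
    have e1 := normSq_add_conj_sub_normSq_sub (h s) (h x)
    have e2 := normSq_add_conj_sub_normSq_sub s x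
    have p1 : 0 < ‖h s + (starRingEnd ℂ) (h x)‖ :=
      norm_pos_iff.2 (add_conj_ne_zero (hpos _ hs) (hpos _ hxre))
    have p2 : 0 < ‖s + x‖ := norm_pos_iff.2 (by simpa using add_conj_ne_zero hs hxre)
    rw [conj_ofReal, ofReal_re] at e2
    rw [norm_div, norm_div, div_le_div_iff₀ p1 p2] at key
    have key2 := pow_le_pow_left₀ (by positivity) key 2
    rw [mul_pow, mul_pow] at key2
    have main : s.re * x * ‖h s + (starRingEnd ℂ) (h x)‖ ^ 2 ≤
        (h s).re * (h x).re * ‖s + x‖ ^ 2 := by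
      have e1' : ‖h s - h x‖ ^ 2 =
          ‖h s + (starRingEnd ℂ) (h x)‖ ^ 2 - 4 * (h s).re * (h x).re := by linarith
      have e2' : ‖s - x‖ ^ 2 = ‖s + x‖ ^ 2 - 4 * s.re * x := by linarith
      rw [e1', e2'] at key2
      linarith
    have f1 : h s / x + (starRingEnd ℂ) (h x / x) = (h s + (starRingEnd ℂ) (h x)) / x := by
      rw [map_div₀, conj_ofReal, add_div]
    have f2 : s / x + 1 = (s + x) / x := by field_simp
    rw [f1, f2, norm_div, norm_div, norm_real, Real.norm_of_nonneg hx.le, div_ofReal_re,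
      div_pow, div_pow]
    have := div_le_div_of_nonneg_right main (pow_pos hx 3).le
    convert this using 1 <;> field_simp
  nlinarith

/-- If `c₀ ≥ 1` is an integer and `ψ` is analytic on the right half-plane `ℂ₀`,
agrees on some half-plane `ℂ_{σ₀}` with a convergent Dirichlet series, and
`Re (c₀ s + ψ s) > 0` on `ℂ₀`, then `Re ψ ≥ 0` on `ℂ₀`; moreover either `ψ` is a
constant of real part `0`, or `Re ψ > 0` everywhere on `ℂ₀`. -/
theorem stmt0 (c₀ : ℕ) (hc₀ : 1 ≤ c₀) (ψ : ℂ → ℂ) (c : ℕ → ℂ) (σ₀ : ℝ)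
    (hψ : DifferentiableOn ℂ ψ {s : ℂ | 0 < s.re})
    (hser : ∀ s : ℂ, σ₀ < s.re → LSeriesHasSum c s (ψ s))
    (hmap : ∀ s : ℂ, 0 < s.re → 0 < ((c₀ : ℂ) * s + ψ s).re) :
    (∀ s : ℂ, 0 < s.re → 0 ≤ (ψ s).re) ∧
      ((∃ w : ℂ, w.re = 0 ∧ ∀ s : ℂ, 0 < s.re → ψ s = w) ∨
        ∀ s : ℂ, 0 < s.re → 0 < (ψ s).re) := by
  have hlim0 : Tendsto (fun x : ℝ ↦ ψ x / x) atTop (nhds 0) := by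
    have h1 : σ₀ < ((σ₀ + 1 : ℝ) : ℂ).re := by simp
    set M := ∑' n, ‖LSeries.term c ((σ₀ + 1 : ℝ) : ℂ) n‖
    refine squeeze_zero_norm' (a := fun x ↦ M / x) ?_ (tendsto_const_nhds.div_atTop tendsto_id)
    filter_upwards [eventually_gt_atTop 0, eventually_ge_atTop (σ₀ + 1)] with x hx hx'
    rw [norm_div, norm_real, Real.norm_of_nonneg hx.le]
    gcongr
    refine norm_le_tsum_norm_term_of_LSeriesHasSum (hser _ h1) (hser _ ?_) ?_
    · rw [ofReal_re]; linarith
    · rwa [ofReal_re, ofReal_re]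
  have hlim : Tendsto (fun x : ℝ ↦ ((c₀ : ℂ) * x + ψ x) / x) atTop (nhds ((c₀ : ℝ) : ℂ)) := by
    have h1 := hlim0.const_add (c₀ : ℂ)
    rw [add_zero] at h1
    refine Tendsto.congr' ?_ h1
    filter_upwards [eventually_gt_atTop 0] with x hx
    have hx0 : (x : ℂ) ≠ 0 := by exact_mod_cast hx.ne'
    field_simp
  have hnonneg : ∀ s : ℂ, 0 < s.re → 0 ≤ (ψ s).re := by
    intro s hs
    have hd : DifferentiableOn ℂ (fun s ↦ (c₀ : ℂ) * s + ψ s) {s | 0 < s.re} :=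
      DifferentiableOn.add (by fun_prop) hψ
    have := mul_re_le_re_of_tendsto_div hd hmap (by exact_mod_cast hc₀) hlim hs
    simpa using this
  refine ⟨hnonneg, ?_⟩
  have hopen : IsOpen {s : ℂ | 0 < s.re} := isOpen_lt continuous_const continuous_re
  have hconn : IsPreconnected {s : ℂ | 0 < s.re} := (convex_halfSpace_re_gt 0).isPreconnected
  by_cases hall : ∀ s : ℂ, 0 < s.re → 0 < (ψ s).re
  · exact Or.inr hall
  left
  push Not at hall
  obtain ⟨s₀, hs₀, hle⟩ := hall
  have hz : (ψ s₀).re = 0 := le_antisymm hle (hnonneg s₀ hs₀)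
  rcases (hψ.analyticOnNhd hopen).is_constant_or_isOpen hconn with ⟨w, hw⟩ | ho
  · exact ⟨w, hw s₀ hs₀ ▸ hz, hw⟩
  exfalso
  obtain ⟨ε, hε, hball⟩ := Metric.isOpen_iff.1 (ho _ subset_rfl hopen) (ψ s₀) ⟨s₀, hs₀, rfl⟩
  have hmem : ψ s₀ - ((ε / 2 : ℝ) : ℂ) ∈ Metric.ball (ψ s₀) ε := by
    rw [mem_ball_iff_norm, sub_sub_cancel_left, norm_neg, norm_real,
      Real.norm_of_nonneg (by positivity)]
    linarith
  obtain ⟨t, ht, hte⟩ := hball hmem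
  have := hnonneg t ht
  rw [hte, sub_re, hz, ofReal_re] at this
  linarith
end

section
/- Suppose ψ is analytic with no zeros on ℂ₀ and the harmonic conjugate of log|ψ| is bounded on ℂ₀; that is, ψ = exp∘g for some analytic g on ℂ₀ with Im g bounded. If ψ coincides on some half-plane ℂ_{σ₀} with a convergent Dirichlet series ∑_{n≥1} c_n n^{−s}, then for every ε > 0 this Dirichlet series converges uniformly on ℂ_ε; in particular ψ is bounded on ℂ_ε for every ε > 0. -/
open Complex Filter

/-- The continuous trapezoid equal to `1` on `[-a, a]` and to `0` outside `[-b, b]`. -/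
noncomputable def trapezoid (a b x : ℝ) : ℝ := (max (b - |x|) 0 - max (a - |x|) 0) / (b - a)

/-- The Fourier transform of `trapezoid a b`. -/
noncomputable def trapezoidKernel (a b w : ℝ) : ℝ :=
  (Real.cos (2 * Real.pi * a * w) - Real.cos (2 * Real.pi * b * w)) /
    (2 * (b - a) * Real.pi ^ 2 * w ^ 2)

lemma trapezoid_eq_one {a b x : ℝ} (hab : a < b) (hx : |x| ≤ a) : trapezoid a b x = 1 := by
  rw [trapezoid, max_eq_left (by linarith), max_eq_left (by linarith), div_eq_one_iff_eq]
  · ring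
  · linarith

lemma trapezoid_eq_zero {a b x : ℝ} (hab : a < b) (hx : b ≤ |x|) : trapezoid a b x = 0 := by
  rw [trapezoid, max_eq_right (by linarith), max_eq_right (by linarith), sub_self, zero_div]

lemma integral_exp_mul_triangle {b : ℝ} (hb : 0 ≤ b) {z : ℂ} (hz : z ≠ 0) :
    ∫ x : ℝ, cexp (z * x) * ((max (b - |x|) 0 : ℝ) : ℂ) =
      (cexp (z * b) + cexp (-(z * b)) - 2) / z ^ 2 := by
  have hcont : Continuous fun x : ℝ => cexp (z * x) * ((max (b - |x|) 0 : ℝ) : ℂ) := by fun_prop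
  have hsupp : Function.support (fun x : ℝ => cexp (z * x) * ((max (b - |x|) 0 : ℝ) : ℂ)) ⊆
      Set.Ioc (-b) b := by
    intro x hx
    by_contra hmem
    apply hx
    have : b ≤ |x| := by
      by_contra! h
      exact hmem ⟨(abs_lt.1 h).1, (abs_lt.1 h).2.le⟩
    simp [this]
  rw [← intervalIntegral.integral_eq_integral_of_support_subset hsupp,
    ← intervalIntegral.integral_add_adjacent_intervals (b := 0)
      (hcont.intervalIntegrable _ _) (hcont.intervalIntegrable _ _)]
  have hexp (x : ℝ) : HasDerivAt (fun x : ℝ => cexp (z * x)) (cexp (z * x) * z) x := by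
    simpa using ((hasDerivAt_id x).ofReal_comp.const_mul z).cexp
  have hid (x : ℝ) : HasDerivAt (fun x : ℝ => (x : ℂ)) 1 x := by
    simpa using (hasDerivAt_id x).ofReal_comp
  have h1 : ∫ x : ℝ in (-b)..0, cexp (z * x) * ((max (b - |x|) 0 : ℝ) : ℂ) =
      (b / z - 1 / z ^ 2) + cexp (-(z * b)) / z ^ 2 := by
    have : ∫ x : ℝ in (-b)..0, cexp (z * x) * ((max (b - |x|) 0 : ℝ) : ℂ) =
        ∫ x : ℝ in (-b)..0, cexp (z * x) * (b + x) := by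
      apply intervalIntegral.integral_congr
      intro x hx
      rw [Set.uIcc_of_le (by linarith)] at hx
      simp only
      rw [abs_of_nonpos hx.2, max_eq_left (by linarith [hx.1])]
      push_cast; ring
    rw [this, intervalIntegral.integral_eq_sub_of_hasDerivAt
      (f := fun x : ℝ => cexp (z * x) * ((b + x) / z - 1 / z ^ 2))]
    · simp [div_eq_mul_inv]
    · intro x _
      refine ((hexp x).fun_mul
        ((((hid x).const_add (b : ℂ)).div_const z).sub_const (1 / z ^ 2))).congr_deriv ?_
      field_simp
      ring
    · exact Continuous.intervalIntegrable (by fun_prop) _ _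
  have h2 : ∫ x : ℝ in 0..b, cexp (z * x) * ((max (b - |x|) 0 : ℝ) : ℂ) =
      cexp (z * b) / z ^ 2 - (b / z + 1 / z ^ 2) := by
    have : ∫ x : ℝ in 0..b, cexp (z * x) * ((max (b - |x|) 0 : ℝ) : ℂ) =
        ∫ x : ℝ in 0..b, cexp (z * x) * (b - x) := by
      apply intervalIntegral.integral_congr
      intro x hx
      rw [Set.uIcc_of_le (by linarith)] at hx
      simp only
      rw [abs_of_nonneg hx.1, max_eq_left (by linarith [hx.2])]
      push_cast; ring
    rw [this, intervalIntegral.integral_eq_sub_of_hasDerivAt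
      (f := fun x : ℝ => cexp (z * x) * ((b - x) / z + 1 / z ^ 2))]
    · simp [div_eq_mul_inv]
    · intro x _
      refine ((hexp x).fun_mul
        ((((hid x).const_sub (b : ℂ)).div_const z).add_const (1 / z ^ 2))).congr_deriv ?_
      field_simp
      ring
    · exact Continuous.intervalIntegrable (by fun_prop) _ _
  rw [h1, h2]
  field_simp
  ring

lemma continuous_trapezoid (a b : ℝ) : Continuous (trapezoid a b) := by
  unfold trapezoid
  fun_prop

lemma integrable_mul_triangle {h : ℝ → ℂ} (hh : Continuous h) (b : ℝ) :
    MeasureTheory.Integrable fun x : ℝ => h x * ((max (b - |x|) 0 : ℝ) : ℂ) := by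
  apply Continuous.integrable_of_hasCompactSupport (by fun_prop)
  apply HasCompactSupport.of_support_subset_isCompact (isCompact_Icc (a := -b) (b := b))
  intro x hx
  by_contra hmem
  apply hx
  have : b ≤ |x| := by
    by_contra! h
    exact hmem ⟨(abs_lt.1 h).1.le, (abs_lt.1 h).2.le⟩
  simp [this]

open FourierTransform in
lemma fourier_trapezoid {a b w : ℝ} (ha : 0 ≤ a) (hab : a < b) (hw : w ≠ 0) :
    𝓕 (fun x => (trapezoid a b x : ℂ)) w = trapezoidKernel a b w := by
  have hz : (-2 * Real.pi * w * I : ℂ) ≠ 0 := by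
    simp [Real.pi_ne_zero, hw]
  have hba : (b - a : ℂ) ≠ 0 := by
    rw [← ofReal_sub, ofReal_ne_zero]; linarith
  rw [Real.fourier_real_eq_integral_exp_smul]
  have : ∀ x : ℝ, cexp (↑(-2 * Real.pi * x * w) * I) • (trapezoid a b x : ℂ) =
      (cexp ((-2 * Real.pi * w * I) * x) * ((max (b - |x|) 0 : ℝ) : ℂ) -
        cexp ((-2 * Real.pi * w * I) * x) * ((max (a - |x|) 0 : ℝ) : ℂ)) / (b - a) := by
    intro x
    rw [trapezoid, smul_eq_mul]
    push_cast
    rw [show (-2 * Real.pi * x * w * I : ℂ) = (-2 * Real.pi * w * I) * x by ring]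
    field_simp
  simp_rw [this]
  rw [MeasureTheory.integral_div, MeasureTheory.integral_sub
    (integrable_mul_triangle (by fun_prop) b) (integrable_mul_triangle (by fun_prop) a),
    integral_exp_mul_triangle (ha.trans hab.le) hz, integral_exp_mul_triangle ha hz,
    trapezoidKernel]
  have hcos (c : ℝ) : cexp ((-2 * Real.pi * w * I) * c) + cexp (-((-2 * Real.pi * w * I) * c)) =
      2 * Complex.cos (2 * Real.pi * c * w) := by
    rw [Complex.two_cos, add_comm]
    congr 2 <;> ring
  rw [hcos, hcos]
  push_cast
  have hpi : (Real.pi : ℂ) ≠ 0 := by simp [Real.pi_ne_zero]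
  have hw' : (w : ℂ) ≠ 0 := by simpa using hw
  have hI : (-2 * Real.pi * w * I : ℂ) ^ 2 = -(4 * Real.pi ^ 2 * w ^ 2) := by
    rw [mul_pow, I_sq]; ring
  rw [hI]
  field_simp
  ring

lemma abs_trapezoidKernel_eq {a b w : ℝ} (hab : a < b) :
    |trapezoidKernel a b w| = |Real.cos (2 * Real.pi * a * w) - Real.cos (2 * Real.pi * b * w)| /
      (2 * (b - a) * Real.pi ^ 2 * w ^ 2) := by
  have : 0 < b - a := sub_pos.2 hab
  rw [trapezoidKernel, abs_div, abs_of_nonneg (a := 2 * (b - a) * Real.pi ^ 2 * w ^ 2)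
    (by positivity)]

lemma abs_cos_sub_cos_le (x y : ℝ) : |Real.cos x - Real.cos y| ≤ |x + y| * |y - x| / 2 := by
  rw [Real.cos_sub_cos, abs_mul, abs_mul]
  have h1 := Real.abs_sin_le_abs (x := (x + y) / 2)
  have h2 := Real.abs_sin_le_abs (x := (x - y) / 2)
  rw [abs_div, abs_two] at h1 h2
  rw [abs_sub_comm] at h2
  have := mul_le_mul h1 h2 (abs_nonneg _) (by positivity)
  norm_num
  linarith

lemma abs_cos_sub_cos_le_abs_sub (x y : ℝ) : |Real.cos x - Real.cos y| ≤ |y - x| := by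
  rw [Real.cos_sub_cos, abs_mul, abs_mul]
  have h1 := Real.abs_sin_le_one ((x + y) / 2)
  have h2 := Real.abs_sin_le_abs (x := (x - y) / 2)
  rw [abs_div, abs_two] at h2
  rw [abs_sub_comm] at h2
  have := mul_le_mul h1 h2 (abs_nonneg _) (by positivity)
  norm_num
  linarith

lemma abs_trapezoidKernel_le_add {a b : ℝ} (ha : 0 ≤ a) (hab : a < b) (w : ℝ) :
    |trapezoidKernel a b w| ≤ a + b := by
  have hba : 0 < b - a := sub_pos.2 hab
  rw [abs_trapezoidKernel_eq hab]
  apply div_le_of_le_mul₀ (by positivity) (by linarith)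
  refine (abs_cos_sub_cos_le _ _).trans_eq ?_
  rw [← abs_mul, show (2 * Real.pi * a * w + 2 * Real.pi * b * w) *
    (2 * Real.pi * b * w - 2 * Real.pi * a * w) =
      4 * Real.pi ^ 2 * w ^ 2 * ((a + b) * (b - a)) by ring, abs_of_nonneg]
  · ring
  · have : 0 ≤ a + b := by linarith
    positivity

lemma abs_trapezoidKernel_le_inv {a b w : ℝ} (hab : a < b) (hw : w ≠ 0) :
    |trapezoidKernel a b w| ≤ |w|⁻¹ := by
  have hba : 0 < b - a := sub_pos.2 hab
  have hw' : 0 < |w| := abs_pos.2 hw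
  rw [abs_trapezoidKernel_eq hab]
  apply div_le_of_le_mul₀ (by positivity) (by positivity)
  refine (abs_cos_sub_cos_le_abs_sub _ _).trans ?_
  rw [show 2 * Real.pi * b * w - 2 * Real.pi * a * w = 2 * (b - a) * Real.pi * w by ring, abs_mul,
    abs_of_nonneg (by positivity), ← sq_abs w]
  field_simp
  linarith [Real.pi_gt_three]

lemma abs_trapezoidKernel_le_inv_sq {a b w : ℝ} (hab : a < b) :
    |trapezoidKernel a b w| ≤ (b - a)⁻¹ * (|w| ^ 2)⁻¹ := by
  have hba : 0 < b - a := sub_pos.2 hab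
  rcases eq_or_ne w 0 with rfl | hw
  · simp [trapezoidKernel]
  have hw' : 0 < |w| := abs_pos.2 hw
  rw [abs_trapezoidKernel_eq hab]
  apply div_le_of_le_mul₀ (by positivity) (by positivity)
  have h1 := Real.abs_cos_le_one (2 * Real.pi * a * w)
  have h2 := Real.abs_cos_le_one (2 * Real.pi * b * w)
  refine (abs_sub _ _).trans ((add_le_add h1 h2).trans ?_)
  rw [← sq_abs w]
  field_simp
  nlinarith [Real.pi_gt_three]

lemma abs_trapezoidKernel_le {a b δ : ℝ} (ha : 0 ≤ a) (hab : a < b) (hδ : 0 < δ) (hδ1 : δ ≤ 1)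
    (w : ℝ) : |trapezoidKernel a b w| ≤
      4 * ((a + b) + (b - a)⁻¹ ^ δ) * (1 + ‖w‖) ^ (-(1 + δ)) := by
  have hba : 0 < b - a := sub_pos.2 hab
  have hinv : 0 ≤ (b - a)⁻¹ ^ δ := by positivity
  rw [Real.norm_eq_abs]
  have h4 : (2 : ℝ) ^ (1 + δ) ≤ 4 := by
    calc (2 : ℝ) ^ (1 + δ) ≤ 2 ^ (2 : ℝ) :=
          Real.rpow_le_rpow_of_exponent_le (by norm_num) (by linarith)
      _ = 4 := by norm_num
  rcases le_total |w| 1 with hw | hw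
  · have h5 : (4 : ℝ)⁻¹ ≤ (1 + |w|) ^ (-(1 + δ)) := by
      rw [Real.rpow_neg (by positivity)]
      gcongr
      refine le_trans ?_ h4
      gcongr
      linarith
    calc |trapezoidKernel a b w| ≤ a + b := abs_trapezoidKernel_le_add ha hab w
      _ ≤ (a + b) + (b - a)⁻¹ ^ δ := by linarith
      _ = 4 * ((a + b) + (b - a)⁻¹ ^ δ) * 4⁻¹ := by ring
      _ ≤ _ := by gcongr; linarith
  · have hw0 : 0 < |w| := by linarith
    have h6 : |w| ^ (-(1 + δ)) ≤ 4 * (1 + |w|) ^ (-(1 + δ)) := by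
      rw [Real.rpow_neg hw0.le, Real.rpow_neg (by positivity)]
      have : (1 + |w|) ^ (1 + δ) ≤ 4 * |w| ^ (1 + δ) := by
        calc (1 + |w|) ^ (1 + δ) ≤ (2 * |w|) ^ (1 + δ) := by gcongr; linarith
          _ = 2 ^ (1 + δ) * |w| ^ (1 + δ) := Real.mul_rpow (by norm_num) hw0.le
          _ ≤ _ := by gcongr
      rw [← div_eq_mul_inv, inv_eq_one_div, div_le_div_iff₀ (by positivity) (by positivity)]
      linarith
    calc |trapezoidKernel a b w|
        = |trapezoidKernel a b w| ^ (1 - δ) * |trapezoidKernel a b w| ^ δ := by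
          rw [← Real.rpow_add' (abs_nonneg _) (by norm_num)]; simp
      _ ≤ (|w|⁻¹) ^ (1 - δ) * ((b - a)⁻¹ * (|w| ^ 2)⁻¹) ^ δ := by
          gcongr
          · exact abs_trapezoidKernel_le_inv hab (abs_pos.1 hw0)
          · exact abs_trapezoidKernel_le_inv_sq hab
      _ = (b - a)⁻¹ ^ δ * |w| ^ (-(1 + δ)) := by
          rw [Real.mul_rpow (by positivity) (by positivity), Real.inv_rpow hw0.le,
            Real.inv_rpow (x := |w| ^ 2) (by positivity), ← Real.rpow_natCast, ← Real.rpow_mul hw0.le,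
            ← Real.rpow_neg hw0.le, ← Real.rpow_neg hw0.le, mul_left_comm, ← Real.rpow_add hw0]
          congr 2
          push_cast; ring
      _ ≤ ((a + b) + (b - a)⁻¹ ^ δ) * (4 * (1 + |w|) ^ (-(1 + δ))) :=
          mul_le_mul (by linarith) h6 (by positivity) (by linarith)
      _ = _ := by ring

lemma measurable_trapezoidKernel (a b : ℝ) : Measurable (trapezoidKernel a b) := by
  unfold trapezoidKernel
  fun_prop

lemma integrable_trapezoidKernel {a b : ℝ} (ha : 0 ≤ a) (hab : a < b) :
    MeasureTheory.Integrable (trapezoidKernel a b) := by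
  refine MeasureTheory.Integrable.mono'
    ((integrable_one_add_norm (μ := MeasureTheory.volume) (r := 1 + 1) (by simp)).const_mul _)
    (measurable_trapezoidKernel a b).aestronglyMeasurable
    (.of_forall fun w => abs_trapezoidKernel_le ha hab one_pos le_rfl w)

lemma integral_abs_trapezoidKernel_log_le {δ : ℝ} (hδ : 0 < δ) (hδ1 : δ ≤ 1) :
    ∃ C : ℝ, 0 ≤ C ∧ ∀ N : ℕ, 1 ≤ N →
      ∫ w, |trapezoidKernel (Real.log N) (Real.log (N + 1)) w| ≤ C * ((N : ℝ) + 1) ^ δ := by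
  set J : ℝ := ∫ w : ℝ, (1 + ‖w‖) ^ (-(1 + δ)) with hJ
  have hJ0 : 0 ≤ J := MeasureTheory.integral_nonneg fun w => by positivity
  refine ⟨4 * (2 / δ + 1) * J, by positivity, fun N hN => ?_⟩
  have hN0 : (0 : ℝ) < N := by exact_mod_cast hN
  have hlog : Real.log N < Real.log (N + 1) := Real.log_lt_log hN0 (by linarith)
  have hlog0 : 0 ≤ Real.log N := Real.log_nonneg (by exact_mod_cast hN)
  have hgap : (Real.log (N + 1) - Real.log N)⁻¹ ≤ (N : ℝ) + 1 := by
    rw [← Real.log_div (by positivity) (by positivity)]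
    have h := Real.one_sub_inv_le_log_of_pos (x := ((N : ℝ) + 1) / N) (by positivity)
    apply inv_le_of_inv_le₀ (by positivity)
    refine le_trans (le_of_eq ?_) h
    field_simp
    ring
  have hsum : Real.log N + Real.log (N + 1) ≤ 2 / δ * ((N : ℝ) + 1) ^ δ := by
    have := Real.log_le_rpow_div (x := (N : ℝ) + 1) (by positivity) hδ
    calc _ ≤ 2 * Real.log (N + 1) := by linarith
      _ ≤ 2 * (((N : ℝ) + 1) ^ δ / δ) := by gcongr
      _ = _ := by ring
  calc ∫ w, |trapezoidKernel (Real.log N) (Real.log (N + 1)) w|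
      ≤ ∫ w : ℝ, 4 * ((Real.log N + Real.log (N + 1)) +
          (Real.log (N + 1) - Real.log N)⁻¹ ^ δ) * (1 + ‖w‖) ^ (-(1 + δ)) := by
        apply MeasureTheory.integral_mono (integrable_trapezoidKernel hlog0 hlog).abs
        · exact (integrable_one_add_norm (by simpa using hδ)).const_mul _
        · exact fun w => abs_trapezoidKernel_le hlog0 hlog hδ hδ1 w
    _ = 4 * ((Real.log N + Real.log (N + 1)) +
          (Real.log (N + 1) - Real.log N)⁻¹ ^ δ) * J := MeasureTheory.integral_const_mul _ _
    _ ≤ 4 * (2 / δ * ((N : ℝ) + 1) ^ δ + ((N : ℝ) + 1) ^ δ) * J := by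
        gcongr
    _ = _ := by ring

open FourierTransform in
lemma integral_trapezoidKernel_mul_exp {a b : ℝ} (ha : 0 ≤ a) (hab : a < b) (x : ℝ) :
    ∫ w : ℝ, (trapezoidKernel a b w : ℂ) * cexp (2 * Real.pi * w * x * I) = trapezoid a b x := by
  have hcont : Continuous fun x => (trapezoid a b x : ℂ) :=
    continuous_ofReal.comp (continuous_trapezoid a b)
  have hint : MeasureTheory.Integrable fun x => (trapezoid a b x : ℂ) := by
    apply hcont.integrable_of_hasCompactSupport
    apply HasCompactSupport.of_support_subset_isCompact (isCompact_Icc (a := -b) (b := b))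
    intro x hx
    by_contra hmem
    apply hx
    refine ofReal_eq_zero.2 (trapezoid_eq_zero hab ?_)
    by_contra! h
    exact hmem ⟨(abs_lt.1 h).1.le, (abs_lt.1 h).2.le⟩
  have hae : 𝓕 (fun x => (trapezoid a b x : ℂ)) =ᵐ[MeasureTheory.volume]
      fun w => (trapezoidKernel a b w : ℂ) := by
    filter_upwards [MeasureTheory.Measure.ae_ne MeasureTheory.volume (0 : ℝ)] with w hw
    exact fourier_trapezoid ha hab hw
  have hint' : MeasureTheory.Integrable (𝓕 (fun x => (trapezoid a b x : ℂ))) :=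
    (integrable_trapezoidKernel ha hab).ofReal.congr hae.symm
  have := congrFun (hcont.fourierInv_fourier_eq hint hint') x
  rw [← this, Real.fourierInv_congr_ae hae, Real.fourierInv_eq']
  congr 1
  ext w
  simp [mul_comm, mul_left_comm, mul_assoc]

lemma LSeries_term_add_mul_I (c : ℕ → ℂ) (s : ℂ) (w : ℝ) (n : ℕ) :
    LSeries.term c (s + 2 * Real.pi * w * I) n =
      LSeries.term c s n * cexp (2 * Real.pi * w * (-Real.log n : ℝ) * I) := by
  rcases eq_or_ne n 0 with rfl | hn
  · simp
  have hn' : (n : ℂ) ≠ 0 := by exact_mod_cast hn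
  rw [LSeries.term_of_ne_zero hn, LSeries.term_of_ne_zero hn, cpow_add _ _ hn', div_mul_eq_div_div,
    div_eq_mul_inv (c n / _), ← cpow_neg, cpow_def_of_ne_zero hn' (-_), ofReal_neg, natCast_log]
  congr 2
  ring

lemma integral_trapezoidKernel_mul_of_LSeriesHasSum {c : ℕ → ℂ} {f : ℂ → ℂ} {σ₀ : ℝ}
    (hser : ∀ s : ℂ, σ₀ < s.re → LSeriesHasSum c s (f s)) {s : ℂ} (hs : σ₀ < s.re) {N : ℕ}
    (hN : 1 ≤ N) :
    ∫ w : ℝ, (trapezoidKernel (Real.log N) (Real.log (N + 1)) w : ℂ) *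
      f (s + 2 * Real.pi * w * I) = ∑ n ∈ Finset.range (N + 1), LSeries.term c s n := by
  have hN0 : (0 : ℝ) < N := by exact_mod_cast hN
  have hlog : Real.log N < Real.log (N + 1) := Real.log_lt_log hN0 (by linarith)
  have hlog0 : 0 ≤ Real.log N := Real.log_nonneg (by exact_mod_cast hN)
  set K := trapezoidKernel (Real.log N) (Real.log (N + 1)) with hK
  have hKint : MeasureTheory.Integrable K := integrable_trapezoidKernel hlog0 hlog
  set F : ℕ → ℝ → ℂ := fun n w =>
    LSeries.term c s n * ((K w : ℂ) * cexp (2 * Real.pi * w * (-Real.log n : ℝ) * I)) with hF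
  have hnorm (n : ℕ) (w : ℝ) : ‖(K w : ℂ) * cexp (2 * Real.pi * w * (-Real.log n : ℝ) * I)‖ =
      |K w| := by
    rw [norm_mul, norm_real, Real.norm_eq_abs,
      show (2 * Real.pi * w * (-Real.log n : ℝ) * I : ℂ) =
        ((2 * Real.pi * w * (-Real.log n) : ℝ) : ℂ) * I by push_cast; ring,
      norm_exp_ofReal_mul_I, mul_one]
  have hFint (n : ℕ) : MeasureTheory.Integrable (F n) := by
    refine MeasureTheory.Integrable.const_mul (hKint.abs.mono' ?_ ?_) _
    · exact hKint.ofReal.aestronglyMeasurable.mul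
        (Continuous.aestronglyMeasurable (by fun_prop))
    · exact .of_forall fun w => (hnorm n w).le
  have hsum : Summable fun n => ∫ w, ‖F n w‖ := by
    have h (n : ℕ) : ∫ w, ‖F n w‖ = ‖LSeries.term c s n‖ * ∫ w, |K w| := by
      simp_rw [hF, norm_mul (LSeries.term c s n), hnorm]
      exact MeasureTheory.integral_const_mul _ _
    simp_rw [h]
    exact (hser s hs).summable.norm.mul_right _
  have hmain := MeasureTheory.hasSum_integral_of_summable_integral_norm hFint hsum
  have hpoint (w : ℝ) : ∑' n, F n w = (K w : ℂ) * f (s + 2 * Real.pi * w * I) := by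
    have h := (hser (s + 2 * Real.pi * w * I) (by simpa using hs)).mul_left (K w : ℂ)
    rw [← h.tsum_eq]
    refine tsum_congr fun n => ?_
    rw [LSeries_term_add_mul_I, hF]
    ring
  simp_rw [hpoint] at hmain
  have hcoef (n : ℕ) : ∫ w, F n w = LSeries.term c s n *
      trapezoid (Real.log N) (Real.log (N + 1)) (-Real.log n) := by
    rw [← integral_trapezoidKernel_mul_exp hlog0 hlog]
    exact MeasureTheory.integral_const_mul _ _
  have habs (n : ℕ) : |(-Real.log n)| = Real.log n := by
    rw [abs_neg, abs_of_nonneg (Real.log_natCast_nonneg n)]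
  rw [← hmain.tsum_eq, tsum_eq_sum (s := Finset.range (N + 1))]
  · refine Finset.sum_congr rfl fun n hn => ?_
    rcases eq_or_ne n 0 with rfl | hn0
    · simp [hcoef]
    rw [hcoef, trapezoid_eq_one hlog, ofReal_one, mul_one]
    rw [habs]
    have hnN : n ≤ N := by simpa [Nat.lt_succ_iff] using hn
    exact Real.log_le_log (by exact_mod_cast Nat.pos_of_ne_zero hn0) (by exact_mod_cast hnN)
  · intro n hn
    rw [hcoef, trapezoid_eq_zero hlog, ofReal_zero, mul_zero]
    rw [habs]
    have hnN : N + 1 ≤ n := by simpa using hn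
    exact Real.log_le_log (by positivity) (by exact_mod_cast hnN)

lemma differentiableOn_integral_mul_vertical_translate {K : ℝ → ℝ}
    (hK : MeasureTheory.Integrable K) {f : ℂ → ℂ} {θ M : ℝ}
    (hf : DifferentiableOn ℂ f {s : ℂ | θ < s.re}) (hM : ∀ s : ℂ, θ < s.re → ‖f s‖ ≤ M) :
    DifferentiableOn ℂ (fun s => ∫ w : ℝ, (K w : ℂ) * f (s + 2 * Real.pi * w * I))
      {s : ℂ | θ < s.re} := by
  intro s hs
  have hs' : θ < s.re := hs
  set r : ℝ := (s.re - θ) / 2 with hr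
  have hr0 : 0 < r := by linarith
  have hre (z : ℂ) (w : ℝ) : (z + 2 * Real.pi * w * I).re = z.re := by simp
  have hmeas (h : ℂ → ℂ) (hh : ContinuousOn h {s : ℂ | θ < s.re}) (z : ℂ) (hz : θ < z.re) :
      MeasureTheory.AEStronglyMeasurable
        (fun w : ℝ => (K w : ℂ) * h (z + 2 * Real.pi * w * I)) := by
    refine hK.ofReal.aestronglyMeasurable.mul (Continuous.aestronglyMeasurable ?_)
    exact hh.comp_continuous (by fun_prop) fun w => by simpa [hre] using hz
  have hball : ∀ z ∈ Metric.ball s r, θ + r < z.re := by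
    intro z hz
    rw [Metric.mem_ball, dist_eq] at hz
    have h := (abs_lt.1 ((abs_re_le_norm (z - s)).trans_lt hz)).1
    rw [sub_re] at h
    linarith
  have key := hasDerivAt_integral_of_dominated_loc_of_deriv_le (μ := MeasureTheory.volume)
    (F := fun z w => (K w : ℂ) * f (z + 2 * Real.pi * (w : ℝ) * I))
    (F' := fun z w => (K w : ℂ) * deriv f (z + 2 * Real.pi * (w : ℝ) * I))
    (bound := fun w => |K w| * (M / r)) (Metric.ball_mem_nhds s hr0) ?_ ?_ ?_ ?_ ?_ ?_
  · exact key.2.differentiableAt.differentiableWithinAt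
  · filter_upwards [(isOpen_re_gt θ).mem_nhds hs] with z hz
    exact hmeas f hf.continuousOn z hz
  · refine (hK.abs.mul_const M).mono' (hmeas f hf.continuousOn s hs) (.of_forall fun w => ?_)
    rw [norm_mul, norm_real, Real.norm_eq_abs]
    gcongr
    exact hM _ (by rwa [hre])
  · exact hmeas _ (hf.deriv (isOpen_re_gt θ)).continuousOn s hs
  · refine .of_forall fun w z hz => ?_
    rw [norm_mul, norm_real, Real.norm_eq_abs]
    gcongr
    have hsub : ∀ y ∈ Metric.closedBall (z + 2 * Real.pi * w * I) r, θ < y.re := by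
      intro y hy
      rw [Metric.mem_closedBall, dist_eq] at hy
      have h := (abs_le.1 ((abs_re_le_norm _).trans hy)).1
      rw [sub_re, hre] at h
      linarith [hball z hz]
    refine norm_deriv_le_of_forall_mem_sphere_norm_le hr0 ?_ fun y hy =>
      hM y (hsub y (Metric.sphere_subset_closedBall hy))
    exact DifferentiableOn.diffContOnCl_ball (U := {s : ℂ | θ < s.re}) hf hsub
  · exact hK.abs.mul_const _
  · refine .of_forall fun w z hz => ?_
    have hz' : θ < (z + 2 * Real.pi * w * I).re := by rw [hre]; linarith [hball z hz]
    have h := (hf.differentiableAt ((isOpen_re_gt θ).mem_nhds hz')).hasDerivAt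
    exact (h.comp_add_const z _).const_mul _

lemma eqOn_re_gt_of_eqOn_re_gt {f h : ℂ → ℂ} {θ σ : ℝ}
    (hf : DifferentiableOn ℂ f {s : ℂ | θ < s.re})
    (hh : DifferentiableOn ℂ h {s : ℂ | θ < s.re})
    (heq : ∀ s : ℂ, σ < s.re → θ < s.re → f s = h s) : Set.EqOn f h {s : ℂ | θ < s.re} := by
  have hz : max σ θ < ((max σ θ + 1 : ℝ) : ℂ).re := by simp
  refine (hf.analyticOnNhd (isOpen_re_gt θ)).eqOn_of_preconnected_of_eventuallyEq
    (hh.analyticOnNhd (isOpen_re_gt θ)) (convex_halfSpace_re_gt θ).isPreconnected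
    (z₀ := ((max σ θ + 1 : ℝ) : ℂ)) ((le_max_right _ _).trans_lt hz) ?_
  filter_upwards [(isOpen_re_gt (max σ θ)).mem_nhds hz] with s hs
  exact heq s ((le_max_left _ _).trans_lt hs) ((le_max_right _ _).trans_lt hs)

lemma differentiable_LSeries_term (c : ℕ → ℂ) (n : ℕ) :
    Differentiable ℂ fun s => LSeries.term c s n :=
  fun s => (LSeries.hasDerivAt_term c n s).differentiableAt

lemma norm_sum_range_LSeries_term_le {f : ℂ → ℂ} {c : ℕ → ℂ} {θ σ₀ M δ : ℝ}
    (hf : DifferentiableOn ℂ f {s : ℂ | θ < s.re}) (hM : ∀ s : ℂ, θ < s.re → ‖f s‖ ≤ M)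
    (hser : ∀ s : ℂ, σ₀ < s.re → LSeriesHasSum c s (f s)) (hδ : 0 < δ) (hδ1 : δ ≤ 1) :
    ∃ C : ℝ, 0 ≤ C ∧ ∀ (n : ℕ) (s : ℂ), θ < s.re →
      ‖∑ k ∈ Finset.range n, LSeries.term c s k‖ ≤ C * (n : ℝ) ^ δ := by
  obtain ⟨C, hC0, hC⟩ := integral_abs_trapezoidKernel_log_le hδ hδ1
  have hM0 : 0 ≤ M := (norm_nonneg _).trans (hM ((θ + 1 : ℝ) : ℂ) (by simp))
  refine ⟨C * M, by positivity, fun n s hs => ?_⟩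
  obtain rfl | rfl | ⟨N, hN, rfl⟩ : n = 0 ∨ n = 1 ∨ ∃ N, 1 ≤ N ∧ n = N + 1 := by
    rcases n with _ | _ | n
    · simp
    · simp
    · exact .inr (.inr ⟨n + 1, by simp, rfl⟩)
  · simpa using by positivity
  · simpa using by positivity
  have hN0 : (0 : ℝ) < N := by exact_mod_cast hN
  have hlog : Real.log N < Real.log (N + 1) := Real.log_lt_log hN0 (by linarith)
  have hlog0 : 0 ≤ Real.log N := Real.log_nonneg (by exact_mod_cast hN)
  have hKint := integrable_trapezoidKernel hlog0 hlog
  have heq := eqOn_re_gt_of_eqOn_re_gt (σ := σ₀)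
    (differentiableOn_integral_mul_vertical_translate hKint hf hM)
    (Differentiable.differentiableOn
      (f := fun s => ∑ k ∈ Finset.range (N + 1), LSeries.term c s k)
      (Differentiable.fun_sum fun k _ => differentiable_LSeries_term c k))
    (fun s hs _ => integral_trapezoidKernel_mul_of_LSeriesHasSum hser hs hN) hs
  simp only at heq
  rw [← heq]
  calc _ ≤ ∫ w, |trapezoidKernel (Real.log N) (Real.log (N + 1)) w| * M := by
        refine MeasureTheory.norm_integral_le_of_norm_le (hKint.abs.mul_const M)
          (.of_forall fun w => ?_)
        rw [norm_mul, norm_real, Real.norm_eq_abs]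
        gcongr
        exact hM _ (by simpa using hs)
    _ = (∫ w, |trapezoidKernel (Real.log N) (Real.log (N + 1)) w|) * M :=
        MeasureTheory.integral_mul_const _ _
    _ ≤ C * ((N : ℝ) + 1) ^ δ * M := by gcongr; exact hC N hN
    _ = _ := by push_cast; ring

lemma sum_range_mul_eq_mul_sum_add (x : ℕ → ℂ) (a : ℕ → ℂ) (n : ℕ) :
    ∑ i ∈ Finset.range n, x i * a i = x n * ∑ i ∈ Finset.range n, a i +
      ∑ i ∈ Finset.range n, (x i - x (i + 1)) * ∑ k ∈ Finset.range (i + 1), a k := by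
  induction n with
  | zero => simp
  | succ n ih =>
    rw [Finset.sum_range_succ, ih, Finset.sum_range_succ (fun i => (x i - x (i + 1)) * _),
      Finset.sum_range_succ a]
    ring

lemma LSeries_term_eq_rpow_neg_mul (c : ℕ → ℂ) (s : ℂ) (η : ℝ) (n : ℕ) :
    LSeries.term c s n = (((n : ℝ) ^ (-η) : ℝ) : ℂ) * LSeries.term c (s - η) n := by
  rcases eq_or_ne n 0 with rfl | hn
  · simp
  have hn' : (n : ℂ) ≠ 0 := by exact_mod_cast hn
  rw [LSeries.term_of_ne_zero hn, LSeries.term_of_ne_zero hn, cpow_sub _ _ hn',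
    ofReal_cpow (by positivity), ofReal_neg, cpow_neg, ofReal_natCast]
  have : (n : ℂ) ^ (η : ℂ) ≠ 0 := by simp [cpow_eq_zero_iff, hn]
  have : (n : ℂ) ^ s ≠ 0 := by simp [cpow_eq_zero_iff, hn]
  field_simp

lemma summable_abs_rpow_neg_sub {δ : ℝ} (hδ : 0 < δ) :
    Summable fun i : ℕ => |(i : ℝ) ^ (-δ) - ((i + 1 : ℕ) : ℝ) ^ (-δ)| := by
  rw [← summable_nat_add_iff 1]
  refine summable_of_sum_range_le (c := 1) (fun _ => abs_nonneg _) fun n => ?_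
  have h (i : ℕ) : |((i + 1 : ℕ) : ℝ) ^ (-δ) - ((i + 1 + 1 : ℕ) : ℝ) ^ (-δ)| =
      ((i + 1 : ℕ) : ℝ) ^ (-δ) - ((i + 1 + 1 : ℕ) : ℝ) ^ (-δ) := by
    refine abs_of_nonneg (sub_nonneg.2 ?_)
    refine Real.rpow_le_rpow_of_nonpos (by positivity) ?_ (by linarith)
    push_cast
    linarith
  simp_rw [h]
  rw [Finset.sum_range_sub' fun i : ℕ => ((i + 1 : ℕ) : ℝ) ^ (-δ)]
  simp only [zero_add, Nat.cast_one, Real.one_rpow]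
  have : 0 ≤ ((n + 1 : ℕ) : ℝ) ^ (-δ) := by positivity
  linarith

lemma abs_rpow_neg_sub_mul_rpow_le {δ : ℝ} (hδ : 0 < δ) (hδ1 : δ ≤ 1) {i : ℕ} (hi : i ≠ 0) :
    |(i : ℝ) ^ (-(2 * δ)) - ((i + 1 : ℕ) : ℝ) ^ (-(2 * δ))| * ((i + 1 : ℕ) : ℝ) ^ δ ≤
      3 * |(i : ℝ) ^ (-δ) - ((i + 1 : ℕ) : ℝ) ^ (-δ)| := by
  have hi1 : (1 : ℝ) ≤ i := by exact_mod_cast Nat.one_le_iff_ne_zero.2 hi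
  have hi0 : (0 : ℝ) < i := by linarith
  have hsq (x : ℝ) (hx : 0 < x) : x ^ (-(2 * δ)) = x ^ (-δ) * x ^ (-δ) := by
    rw [← Real.rpow_add hx]; congr 1; ring
  have h1 : (i : ℝ) ^ (-δ) * ((i + 1 : ℕ) : ℝ) ^ δ ≤ 2 := by
    calc (i : ℝ) ^ (-δ) * ((i + 1 : ℕ) : ℝ) ^ δ ≤ (i : ℝ) ^ (-δ) * (2 * i) ^ δ := by
          gcongr
          push_cast
          linarith
      _ = 2 ^ δ := by
          rw [Real.mul_rpow (by norm_num) hi0.le, mul_left_comm, ← Real.rpow_add hi0]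
          simp
      _ ≤ 2 ^ (1 : ℝ) := Real.rpow_le_rpow_of_exponent_le (by norm_num) hδ1
      _ = 2 := by norm_num
  have h2 : ((i + 1 : ℕ) : ℝ) ^ (-δ) * ((i + 1 : ℕ) : ℝ) ^ δ = 1 := by
    rw [← Real.rpow_add (by positivity)]
    simp
  rw [hsq _ hi0, hsq _ (by positivity), mul_self_sub_mul_self, abs_mul,
    abs_of_nonneg (a := (i : ℝ) ^ (-δ) + ((i + 1 : ℕ) : ℝ) ^ (-δ)) (by positivity)]
  calc _ = ((i : ℝ) ^ (-δ) * ((i + 1 : ℕ) : ℝ) ^ δ +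
        ((i + 1 : ℕ) : ℝ) ^ (-δ) * ((i + 1 : ℕ) : ℝ) ^ δ) *
          |(i : ℝ) ^ (-δ) - ((i + 1 : ℕ) : ℝ) ^ (-δ)| := by ring
    _ ≤ (2 + 1) * |(i : ℝ) ^ (-δ) - ((i + 1 : ℕ) : ℝ) ^ (-δ)| := by gcongr; exact h2.le
    _ = _ := by norm_num

/-- **Bohr's theorem**: a Dirichlet series with a bounded analytic extension to `re s > θ`
converges uniformly on every smaller half-plane. -/
theorem tendstoUniformlyOn_LSeries_of_norm_le {f : ℂ → ℂ} {c : ℕ → ℂ} {θ σ₀ M ε : ℝ}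
    (hf : DifferentiableOn ℂ f {s : ℂ | θ < s.re}) (hM : ∀ s : ℂ, θ < s.re → ‖f s‖ ≤ M)
    (hser : ∀ s : ℂ, σ₀ < s.re → LSeriesHasSum c s (f s)) (hε : θ < ε) :
    TendstoUniformlyOn (fun N s => ∑ n ∈ Finset.range N, LSeries.term c s n) f
      atTop {s : ℂ | ε < s.re} := by
  obtain ⟨δ, hδ, hδ1, hδε⟩ : ∃ δ : ℝ, 0 < δ ∧ δ ≤ 1 ∧ 2 * δ ≤ ε - θ := by
    refine ⟨min ((ε - θ) / 2) 1, lt_min (by linarith) one_pos, min_le_right _ _, ?_⟩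
    linarith [min_le_left ((ε - θ) / 2) 1]
  obtain ⟨C, hC0, hC⟩ := norm_sum_range_LSeries_term_le hf hM hser hδ hδ1
  set x : ℕ → ℝ := fun n => (n : ℝ) ^ (-(2 * δ)) with hx
  set A : ℕ → ℂ → ℂ := fun n s =>
    ∑ k ∈ Finset.range n, LSeries.term c (s - (2 * δ : ℝ)) k with hA
  have hAC (n : ℕ) (s : ℂ) (hs : s ∈ {s : ℂ | ε < s.re}) : ‖A n s‖ ≤ C * (n : ℝ) ^ δ := by
    have hs' : ε < s.re := hs
    refine hC n _ ?_
    rw [sub_re, ofReal_re]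
    linarith
  have hfirst : TendstoUniformlyOn (fun n s => (x n : ℂ) * A n s) (fun _ => 0) atTop
      {s : ℂ | ε < s.re} := by
    rw [Metric.tendstoUniformlyOn_iff]
    intro e he
    have hlim : Tendsto (fun n : ℕ => C * (n : ℝ) ^ (-δ)) atTop (nhds 0) := by
      simpa using ((tendsto_rpow_neg_atTop hδ).comp tendsto_natCast_atTop_atTop).const_mul C
    filter_upwards [hlim.eventually_lt_const he, eventually_ge_atTop 1] with n hn hn1 s hs
    have hn0 : (0 : ℝ) < n := by exact_mod_cast hn1
    rw [dist_zero_left, norm_mul, norm_real, Real.norm_eq_abs, abs_of_nonneg (by positivity)]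
    refine lt_of_le_of_lt ?_ hn
    calc x n * ‖A n s‖ ≤ x n * (C * (n : ℝ) ^ δ) := by
          gcongr
          exact hAC n s hs
      _ = C * ((n : ℝ) ^ (-(2 * δ)) * (n : ℝ) ^ δ) := by ring
      _ = C * (n : ℝ) ^ (-δ) := by
          rw [← Real.rpow_add hn0]
          congr 2
          ring
  have hsecond := tendstoUniformlyOn_tsum_nat (s := {s : ℂ | ε < s.re})
    (f := fun i s => ((x i : ℂ) - x (i + 1)) * A (i + 1) s)
    ((summable_abs_rpow_neg_sub hδ).mul_left (C * 3)) (fun i s hs => by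
      rcases eq_or_ne i 0 with rfl | hi
      · simp only [hA, zero_add, Finset.sum_range_one, LSeries.term_zero, mul_zero, norm_zero]
        positivity
      rw [norm_mul, ← ofReal_sub, norm_real, Real.norm_eq_abs]
      calc _ ≤ |x i - x (i + 1)| * (C * ((i + 1 : ℕ) : ℝ) ^ δ) := by
            gcongr
            exact hAC _ s hs
        _ = C * (|x i - x (i + 1)| * ((i + 1 : ℕ) : ℝ) ^ δ) := by ring
        _ ≤ C * (3 * |(i : ℝ) ^ (-δ) - ((i + 1 : ℕ) : ℝ) ^ (-δ)|) :=
            mul_le_mul_of_nonneg_left (abs_rpow_neg_sub_mul_rpow_le hδ hδ1 hi) hC0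
        _ = _ := by ring)
  have hlim : TendstoUniformlyOn (fun N s => ∑ n ∈ Finset.range N, LSeries.term c s n)
      (fun s => 0 + ∑' i, ((x i : ℂ) - x (i + 1)) * A (i + 1) s) atTop {s : ℂ | ε < s.re} := by
    refine (hfirst.add hsecond).congr (.of_forall fun n s _ => ?_)
    simp only [Pi.add_apply]
    rw [Finset.sum_congr rfl fun k _ => LSeries_term_eq_rpow_neg_mul c s (2 * δ) k,
      sum_range_mul_eq_mul_sum_add (fun k => (x k : ℂ))]
  refine hlim.congr_right (eqOn_re_gt_of_eqOn_re_gt (σ := σ₀) ?_ (hf.mono ?_) ?_)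
  · exact hlim.tendstoLocallyUniformlyOn.differentiableOn
      (.of_forall fun n => (Differentiable.fun_sum fun k _ =>
        differentiable_LSeries_term c k).differentiableOn) (Complex.isOpen_re_gt ε)
  · exact fun s hs => hε.trans hs
  · exact fun s hs hs' =>
      tendsto_nhds_unique (hlim.tendsto_at hs') (hser s hs).tendsto_sum_nat

lemma norm_sub_le_of_abs_im_le {g : ℂ → ℂ} {B : ℝ}
    (hg : DifferentiableOn ℂ g {s : ℂ | 0 < s.re}) (hIm : ∀ s : ℂ, 0 < s.re → |(g s).im| ≤ B)
    {p q : ℂ} (hpq : ‖q - p‖ < p.re) :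
    ‖g q - g p‖ ≤ 2 * (2 * B + 1) * ‖q - p‖ / (p.re - ‖q - p‖) := by
  have hp : 0 < p.re := (norm_nonneg _).trans_lt hpq
  have hB : 0 ≤ B := (abs_nonneg _).trans (hIm p hp)
  have hmem : ∀ z ∈ Metric.ball (0 : ℂ) p.re, 0 < (p + z).re := by
    intro z hz
    rw [mem_ball_zero_iff] at hz
    have := (abs_lt.1 ((abs_re_le_norm z).trans_lt hz)).1
    rw [add_re]
    linarith
  have key := borelCaratheodory_zero (f := fun z => -I * (g (p + z) - g p)) (M := 2 * B + 1)
    (R := p.re) (z := q - p) (by positivity) ?_ ?_ hp (by simpa using hpq) (by simp)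
  · simpa using key
  · refine ((hg.comp (by fun_prop) hmem).sub_const _).const_mul _
  · intro z hz
    have h1 := abs_le.1 (hIm _ (hmem z hz))
    have h2 := abs_le.1 (hIm p hp)
    simp
    linarith

lemma exists_norm_sub_coeff_one_le {c : ℕ → ℂ} {f : ℂ → ℂ} {σ₀ σ : ℝ}
    (hser : ∀ s : ℂ, σ₀ < s.re → LSeriesHasSum c s (f s)) (hσ : σ₀ < σ) :
    ∃ C : ℝ, 0 ≤ C ∧ ∀ s : ℂ, σ ≤ s.re → ‖f s - c 1‖ ≤ C * 2 ^ (-(s.re - σ)) := by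
  have hsum := (hser (σ : ℂ) (by simpa using hσ)).summable.norm
  refine ⟨∑' n, ‖LSeries.term c σ n‖, tsum_nonneg fun _ => norm_nonneg _, fun s hs => ?_⟩
  have hs_sum : HasSum (LSeries.term c s) (f s) := hser s (hσ.trans_le hs)
  have hsub := hs_sum.sub (hasSum_ite_eq 1 (c 1))
  rw [← hsub.tsum_eq]
  refine tsum_of_norm_bounded (hsum.hasSum.mul_right _) fun n => ?_
  obtain rfl | rfl | hn : n = 0 ∨ n = 1 ∨ 2 ≤ n := by omega
  · simp
  · simp only [if_true]
    rw [LSeries.term_of_ne_zero one_ne_zero]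
    simp only [Nat.cast_one, one_cpow, div_one, sub_self, norm_zero]
    positivity
  · have hn2 : (2 : ℝ) ≤ n := by exact_mod_cast hn
    have hn0 : (0 : ℝ) < n := by linarith
    rw [if_neg (by omega), sub_zero, LSeries.norm_term_eq, LSeries.norm_term_eq,
      if_neg (by omega), if_neg (by omega), ofReal_re]
    calc ‖c n‖ / (n : ℝ) ^ s.re = ‖c n‖ / (n : ℝ) ^ σ * (n : ℝ) ^ (-(s.re - σ)) := by
          rw [neg_sub, Real.rpow_sub hn0]
          field_simp
      _ ≤ ‖c n‖ / (n : ℝ) ^ σ * 2 ^ (-(s.re - σ)) := by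
          gcongr ?_ * ?_
          exact Real.rpow_le_rpow_of_nonpos two_pos hn2 (by linarith)

lemma coeff_one_ne_zero {g : ℂ → ℂ} {c : ℕ → ℂ} {σ₀ B : ℝ} {ψ : ℂ → ℂ}
    (hg : DifferentiableOn ℂ g {s : ℂ | 0 < s.re}) (hψg : ∀ s : ℂ, 0 < s.re → ψ s = cexp (g s))
    (hIm : ∀ s : ℂ, 0 < s.re → |(g s).im| ≤ B)
    (hser : ∀ s : ℂ, σ₀ < s.re → LSeriesHasSum c s (ψ s)) : c 1 ≠ 0 := by
  intro hc
  obtain ⟨C, hC0, hC⟩ := exists_norm_sub_coeff_one_le hser (lt_add_one σ₀)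
  set L : ℝ := 2 * (2 * B + 1) with hL
  have hstep (k : ℕ) : ‖g ((2 ^ k : ℝ) : ℂ) - g ((1 : ℝ) : ℂ)‖ ≤ k * L := by
    induction k with
    | zero => simp
    | succ k ih =>
      have hnorm : ‖((2 ^ k : ℝ) : ℂ) - ((2 ^ (k + 1) : ℝ) : ℂ)‖ = 2 ^ k := by
        rw [← ofReal_sub, norm_real, Real.norm_eq_abs, abs_sub_comm, pow_succ,
          show (2 : ℝ) ^ k * 2 - 2 ^ k = 2 ^ k by ring, abs_of_pos (by positivity)]
      have hpk : (0 : ℝ) < 2 ^ k := by positivity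
      have h := norm_sub_le_of_abs_im_le hg hIm (p := ((2 ^ (k + 1) : ℝ) : ℂ))
        (q := ((2 ^ k : ℝ) : ℂ)) (by rw [hnorm, ofReal_re, pow_succ]; linarith)
      rw [hnorm, ofReal_re, show (2 : ℝ) ^ (k + 1) - 2 ^ k = 2 ^ k by ring,
        mul_div_cancel_right₀ _ hpk.ne', norm_sub_rev] at h
      have := norm_sub_le_norm_sub_add_norm_sub (g ((2 ^ (k + 1) : ℝ) : ℂ))
        (g ((2 ^ k : ℝ) : ℂ)) (g ((1 : ℝ) : ℂ))
      push_cast at *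
      linarith
  have hupper : Tendsto (fun k : ℕ => C * Real.exp (Real.log 2 * (σ₀ + 1)) *
      Real.exp ((2 : ℝ) ^ k * (k / 2 ^ k * L - Real.log 2))) atTop (nhds 0) := by
    rw [← mul_zero (C * Real.exp (Real.log 2 * (σ₀ + 1)))]
    refine (Real.tendsto_exp_atBot.comp ?_).const_mul _
    have h1 : Tendsto (fun k : ℕ => (k : ℝ) / 2 ^ k * L - Real.log 2) atTop
        (nhds (0 * L - Real.log 2)) := by
      have := tendsto_pow_const_div_const_pow_of_one_lt 1 (r := (2 : ℝ)) (by norm_num)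
      simp only [pow_one] at this
      exact (this.mul_const L).sub_const _
    refine (tendsto_pow_atTop_atTop_of_one_lt (one_lt_two : (1 : ℝ) < 2)).atTop_mul_neg ?_ h1
    have := Real.log_pos one_lt_two
    linarith
  have hpos : 0 < Real.exp (g ((1 : ℝ) : ℂ)).re := Real.exp_pos _
  have hlarge := (tendsto_pow_atTop_atTop_of_one_lt (one_lt_two : (1 : ℝ) < 2)).eventually_ge_atTop
    (σ₀ + 1)
  obtain ⟨k, hk, hk'⟩ := ((hupper.eventually_lt_const hpos).and hlarge).exists
  refine hk.not_ge ?_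
  have hψ := hC ((2 ^ k : ℝ) : ℂ) (by rwa [ofReal_re])
  rw [hc, sub_zero, hψg _ (by rw [ofReal_re]; positivity), norm_exp, ofReal_re] at hψ
  have hre := (abs_le.1 ((abs_re_le_norm _).trans (hstep k))).1
  rw [sub_re] at hre
  have hpk : (0 : ℝ) < 2 ^ k := by positivity
  calc Real.exp (g ((1 : ℝ) : ℂ)).re
      ≤ Real.exp (k * L) * Real.exp (g ((2 ^ k : ℝ) : ℂ)).re := by
        rw [← Real.exp_add]
        exact Real.exp_le_exp.2 (by linarith)
    _ ≤ Real.exp (k * L) * (C * 2 ^ (-(2 ^ k - (σ₀ + 1)))) := by gcongr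
    _ = _ := by
        rw [Real.rpow_def_of_pos two_pos, mul_left_comm, mul_assoc C, ← Real.exp_add,
          ← Real.exp_add]
        congr 2
        field_simp
        ring

lemma exists_norm_le_of_re_ge {g : ℂ → ℂ} {c : ℕ → ℂ} {σ₀ B : ℝ} {ψ : ℂ → ℂ}
    (hg : DifferentiableOn ℂ g {s : ℂ | 0 < s.re}) (hψg : ∀ s : ℂ, 0 < s.re → ψ s = cexp (g s))
    (hIm : ∀ s : ℂ, 0 < s.re → |(g s).im| ≤ B)
    (hser : ∀ s : ℂ, σ₀ < s.re → LSeriesHasSum c s (ψ s)) :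
    ∃ σ D : ℝ, 0 < σ ∧ ∀ s : ℂ, σ ≤ s.re → ‖g s‖ ≤ D := by
  have hc : 0 < ‖c 1‖ := norm_pos_iff.2 (coeff_one_ne_zero hg hψg hIm hser)
  obtain ⟨C, hC0, hC⟩ := exists_norm_sub_coeff_one_le hser (lt_add_one σ₀)
  have hlim : Tendsto (fun x : ℝ => C * 2 ^ (-(x - (σ₀ + 1)))) atTop (nhds 0) := by
    rw [← mul_zero C]
    refine Tendsto.const_mul C ?_
    refine (tendsto_rpow_atBot_of_base_gt_one 2 one_lt_two).comp ?_
    exact tendsto_neg_atTop_atBot.comp (tendsto_atTop_add_const_right _ _ tendsto_id)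
  obtain ⟨σ, hσ⟩ := eventually_atTop.1
    ((hlim.eventually_lt_const (half_pos hc)).and
      ((eventually_ge_atTop (σ₀ + 1)).and (eventually_gt_atTop 0)))
  refine ⟨σ, (|Real.log (‖c 1‖ / 2)| + |Real.log (2 * ‖c 1‖)|) + B, (hσ σ le_rfl).2.2,
    fun s hs => ?_⟩
  obtain ⟨h1, h2, h3⟩ := hσ s.re hs
  have h4 := (hC s h2).trans_lt h1
  rw [hψg s h3] at h4
  have hre : Real.exp (g s).re = ‖cexp (g s)‖ := (norm_exp _).symm
  have hlow : Real.log (‖c 1‖ / 2) ≤ (g s).re := by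
    rw [Real.log_le_iff_le_exp (by positivity), hre]
    linarith [norm_sub_norm_le (c 1) (cexp (g s)), norm_sub_rev (c 1) (cexp (g s))]
  have hupp : (g s).re ≤ Real.log (2 * ‖c 1‖) := by
    rw [Real.le_log_iff_exp_le (by positivity), hre]
    linarith [norm_sub_norm_le (cexp (g s)) (c 1)]
  refine (norm_le_abs_re_add_abs_im _).trans (add_le_add (abs_le.2 ⟨?_, ?_⟩) (hIm s h3))
  · linarith [neg_abs_le (Real.log (‖c 1‖ / 2)), abs_nonneg (Real.log (2 * ‖c 1‖))]
  · linarith [le_abs_self (Real.log (2 * ‖c 1‖)), abs_nonneg (Real.log (‖c 1‖ / 2))]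

lemma exists_norm_le_of_re_gt {g : ℂ → ℂ} {c : ℕ → ℂ} {σ₀ B : ℝ} {ψ : ℂ → ℂ}
    (hg : DifferentiableOn ℂ g {s : ℂ | 0 < s.re}) (hψg : ∀ s : ℂ, 0 < s.re → ψ s = cexp (g s))
    (hIm : ∀ s : ℂ, 0 < s.re → |(g s).im| ≤ B)
    (hser : ∀ s : ℂ, σ₀ < s.re → LSeriesHasSum c s (ψ s)) {ε : ℝ} (hε : 0 < ε) :
    ∃ M : ℝ, ∀ s : ℂ, ε < s.re → ‖ψ s‖ ≤ M := by
  obtain ⟨σ, D, hσ, hD⟩ := exists_norm_le_of_re_ge hg hψg hIm hser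
  have hB : 0 ≤ B := (abs_nonneg _).trans (hIm 1 (by simp))
  have hD0 : 0 ≤ D := (norm_nonneg _).trans (hD (σ : ℂ) (by simp))
  have hE : 0 ≤ 2 * (2 * B + 1) * σ / ε := by positivity
  refine ⟨Real.exp (D + 2 * (2 * B + 1) * σ / ε), fun s hs => ?_⟩
  rw [hψg s (hε.trans hs), norm_exp]
  refine Real.exp_le_exp.2 ((re_le_norm _).trans ?_)
  rcases le_total σ s.re with h | h
  · linarith [hD s h]
  · set p : ℂ := s + (σ - s.re : ℝ) with hp
    have hpre : p.re = σ := by simp [hp]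
    have hnorm : ‖s - p‖ = σ - s.re := by
      rw [hp, sub_add_cancel_left, norm_neg, norm_real, Real.norm_eq_abs,
        abs_of_nonneg (by linarith)]
    have h1 := norm_sub_le_of_abs_im_le hg hIm (p := p) (q := s) (by rw [hnorm, hpre]; linarith)
    rw [hnorm, hpre] at h1
    have h2 : 2 * (2 * B + 1) * (σ - s.re) / (σ - (σ - s.re)) ≤ 2 * (2 * B + 1) * σ / ε := by
      gcongr
      · linarith
      · linarith
    linarith [hD p hpre.ge, norm_sub_norm_le (g s) (g p)]

/-- If `ψ = exp ∘ g` with `g` analytic on `ℂ₀` and `Im g` bounded (i.e. `ψ` is analytic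
and zero-free on `ℂ₀` with bounded harmonic conjugate of `log |ψ|`), and `ψ` agrees on
some half-plane `ℂ_{σ₀}` with a convergent Dirichlet series `∑ c_n n^{-s}`, then for every
`ε > 0` the Dirichlet series converges uniformly on `ℂ_ε`; in particular `ψ` is bounded
on `ℂ_ε` for every `ε > 0`. -/
theorem stmt1 (ψ g : ℂ → ℂ) (c : ℕ → ℂ) (σ₀ : ℝ) (Bg : ℝ)
    (hg : DifferentiableOn ℂ g {s : ℂ | 0 < s.re})
    (hψg : ∀ s : ℂ, 0 < s.re → ψ s = Complex.exp (g s))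
    (hIm : ∀ s : ℂ, 0 < s.re → |(g s).im| ≤ Bg)
    (hser : ∀ s : ℂ, σ₀ < s.re → LSeriesHasSum c s (ψ s)) :
    ∀ ε : ℝ, 0 < ε →
      TendstoUniformlyOn (fun N s => ∑ n ∈ Finset.range N, LSeries.term c s n) ψ
        atTop {s : ℂ | ε < s.re} ∧
      ∃ B : ℝ, ∀ s : ℂ, ε < s.re → ‖ψ s‖ ≤ B := by
  intro ε hε
  have hε2 : 0 < ε / 2 := half_pos hε
  have hψ : DifferentiableOn ℂ ψ {s : ℂ | ε / 2 < s.re} :=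
    (hg.mono fun s hs => hε2.trans hs).cexp.congr fun s hs => hψg s (hε2.trans hs)
  obtain ⟨M, hM⟩ := exists_norm_le_of_re_gt hg hψg hIm hser hε2
  exact ⟨tendstoUniformlyOn_LSeries_of_norm_le hψ hM hser (half_lt_self hε),
    M, fun s hs => hM s ((half_lt_self hε).trans hs)⟩
end
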